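/- arXiv:2309.05837 — 3 statements merged into one kernel-verified Lean document; each statement's English description precedes it below -/
import Mathlib

section
/- (Perfect Safety Filter, existence) There exists a safety filter φ : X → U → U such that: (1) for every x with U^s(x) nonempty and every u ∈ U, φ x u ∈ U^s(x); (2) for every x and every u ∈ U^s(x), φ x u = u; and (3) for every task policy π_task : X → U, every initial state x₀ ∈ Ω*, and every disturbance sequence d : ℕ → D, the filtered closed-loop trajectory x_0 = x₀, x_{t+1} = f x_t (φ x_t (π_task x_t)) (d t) satisfies x_t ∈ Ω* and x_t ∉ F for all t ≥ 0. -/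
/-- Closed-loop trajectory of the uncertain system `f` under policy `π`,
initial state `x₀`, and disturbance sequence `d`. -/
def traj {X U D : Type*} (f : X → U → D → X) (π : X → U) (x₀ : X) (d : ℕ → D) : ℕ → X
  | 0 => x₀
  | t + 1 => f (traj f π x₀ d t) (π (traj f π x₀ d t)) (d t)

/-- `π` is robustly safe from `x₀` if every closed-loop trajectory avoids `F` at all times. -/
def RobustlySafe {X U D : Type*} (f : X → U → D → X) (F : Set X) (π : X → U) (x₀ : X) : Prop :=
  ∀ d : ℕ → D, ∀ t : ℕ, traj f π x₀ d t ∉ F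

/-- The maximal robust safe set: all states from which some policy is robustly safe. -/
def maxSafeSet {X U D : Type*} (f : X → U → D → X) (F : Set X) : Set X :=
  {x | ∃ π : X → U, RobustlySafe f F π x}

/-- The safe control set `U^s(x)`: controls keeping the next state robustly inside `Ω*`. -/
def safeCtrl {X U D : Type*} (f : X → U → D → X) (F : Set X) (x : X) : Set U :=
  {u | ∀ d : D, f x u d ∈ maxSafeSet f F}

theorem traj_succ_eq_traj_step {X U D : Type*} (f : X → U → D → X) (π : X → U) (x₀ : X)
    (d : ℕ → D) (t : ℕ) :
    traj f π x₀ d (t + 1) = traj f π (f x₀ (π x₀) (d 0)) (fun n => d (n + 1)) t := by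
  induction t with
  | zero => rfl
  | succ t ih => rw [traj, ih]; rfl

theorem RobustlySafe.step {X U D : Type*} {f : X → U → D → X} {F : Set X} {π : X → U} {x : X}
    (h : RobustlySafe f F π x) (e : D) : RobustlySafe f F π (f x (π x) e) := by
  intro d t
  have key := h (fun n => Nat.casesOn n e d) (t + 1)
  rwa [traj_succ_eq_traj_step] at key

theorem safeCtrl_nonempty_of_mem_maxSafeSet {X U D : Type*} {f : X → U → D → X} {F : Set X}
    {x : X} (hx : x ∈ maxSafeSet f F) : (safeCtrl f F x).Nonempty := by
  obtain ⟨π, hπ⟩ := hx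
  exact ⟨π x, fun e => ⟨π, hπ.step e⟩⟩

theorem notMem_of_mem_maxSafeSet {X U D : Type*} [Nonempty D] {f : X → U → D → X} {F : Set X}
    {x : X} (hx : x ∈ maxSafeSet f F) : x ∉ F := by
  obtain ⟨π, hπ⟩ := hx
  exact hπ (fun _ => Classical.arbitrary D) 0

theorem traj_mem_maxSafeSet {X U D : Type*} {f : X → U → D → X} {F : Set X} {π : X → U}
    (hπ : ∀ x ∈ maxSafeSet f F, π x ∈ safeCtrl f F x) {x₀ : X} (hx₀ : x₀ ∈ maxSafeSet f F)
    (d : ℕ → D) (t : ℕ) : traj f π x₀ d t ∈ maxSafeSet f F := by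
  induction t with
  | zero => exact hx₀
  | succ t ih => exact hπ _ ih (d t)

/-- Perfect Safety Filter (existence): there is a filter `φ` that (1) outputs a safe
control wherever one exists, (2) leaves safe controls unmodified, and (3) for every task
policy, every initial state in `Ω*`, and every disturbance sequence, the filtered
closed-loop trajectory stays in `Ω*` and outside `F` for all times. -/
theorem stmt_3 {X U D : Type*} [Nonempty X] [Nonempty U] [Nonempty D]
    (f : X → U → D → X) (F : Set X) :
    ∃ φ : X → U → U,
      (∀ x : X, (safeCtrl f F x).Nonempty → ∀ u : U, φ x u ∈ safeCtrl f F x) ∧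
      (∀ x : X, ∀ u ∈ safeCtrl f F x, φ x u = u) ∧
      (∀ πtask : X → U, ∀ x₀ ∈ maxSafeSet f F, ∀ d : ℕ → D, ∀ t : ℕ,
        traj f (fun x => φ x (πtask x)) x₀ d t ∈ maxSafeSet f F ∧
        traj f (fun x => φ x (πtask x)) x₀ d t ∉ F) := by
  classical
  let φ : X → U → U := fun x u =>
    if u ∈ safeCtrl f F x then u
    else if h : (safeCtrl f F x).Nonempty then h.some else u
  have hφ : ∀ x : X, (safeCtrl f F x).Nonempty → ∀ u : U, φ x u ∈ safeCtrl f F x := by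
    intro x hx u
    by_cases hu : u ∈ safeCtrl f F x
    · simp [φ, hu]
    · simpa [φ, hu, hx] using hx.some_mem
  refine ⟨φ, hφ, fun x u hu => if_pos hu, fun πtask x₀ hx₀ d t => ?_⟩
  have hmem := traj_mem_maxSafeSet (π := fun x => φ x (πtask x))
    (fun x hx => hφ x (safeCtrl_nonempty_of_mem_maxSafeSet hx) _) hx₀ d t
  exact ⟨hmem, notMem_of_mem_maxSafeSet hmem⟩
end

section
/- (Finite-horizon game value) For every n ∈ ℕ and x ∈ X, W n x is the upper value of the finite-horizon game of degree with payoff min_{t ≤ n} g(x_t): (i) there exists a time-varying feedback policy π : ℕ → X → U such that for every disturbance sequence d : ℕ → D, min over t ≤ n of g (x_t) ≥ W n x along the trajectory x_0 = x, x_{t+1} = f x_t (π t x_t) (d t); and (ii) for every time-varying feedback policy π : ℕ → X → U there exists a disturbance sequence d : ℕ → D such that min over t ≤ n of g (x_t) ≤ W n x along the corresponding trajectory. -/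
/-- Finite-horizon safety value functions from the discrete-time Isaacs backward
induction: `W 0 = g`, `W (n+1) x = min (g x) (max_u min_d W n (f x u d))`. -/
noncomputable def W {X U D : Type*} [Fintype U] [Nonempty U] [Fintype D] [Nonempty D]
    (f : X → U → D → X) (g : X → ℝ) : ℕ → X → ℝ
  | 0 => g
  | n + 1 => fun x => min (g x)
      (Finset.univ.sup' Finset.univ_nonempty fun u : U =>
        Finset.univ.inf' Finset.univ_nonempty fun d : D => W f g n (f x u d))

/-- Closed-loop trajectory under a time-varying feedback policy `π : ℕ → X → U`. -/
def tvtraj {X U D : Type*} (f : X → U → D → X) (π : ℕ → X → U) (x₀ : X) (d : ℕ → D) :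
    ℕ → X
  | 0 => x₀
  | t + 1 => f (tvtraj f π x₀ d t) (π t (tvtraj f π x₀ d t)) (d t)

theorem tvtraj_succ {X U D : Type*} (f : X → U → D → X) (π : ℕ → X → U) (x : X) (d : ℕ → D)
    (t : ℕ) :
    tvtraj f π x d (t + 1) =
      tvtraj f (fun s => π (s + 1)) (f x (π 0 x) (d 0)) (fun s => d (s + 1)) t := by
  induction t with
  | zero => rfl
  | succ t ih => rw [tvtraj, ih]; rfl

theorem inf'_Iic_succ {α : Type*} [LinearOrder α] (F : ℕ → α) (n : ℕ) :
    (Finset.Iic (n + 1)).inf' Finset.nonempty_Iic F =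
      min (F 0) ((Finset.Iic n).inf' Finset.nonempty_Iic fun t => F (t + 1)) := by
  refine eq_of_forall_le_iff fun c => ?_
  simp only [Finset.le_inf'_iff, Finset.mem_Iic, le_min_iff]
  refine ⟨fun h => ⟨h 0 (by lia), fun t ht => h (t + 1) (by lia)⟩, fun h t ht => ?_⟩
  cases t with
  | zero => exact h.1
  | succ t => exact h.2 t (by lia)

/-- One step of the payoff along a closed-loop trajectory. -/
theorem payoff_succ {X U D : Type*} (f : X → U → D → X) (g : X → ℝ) (π : ℕ → X → U) (x : X)
    (d : ℕ → D) (n : ℕ) :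
    (Finset.Iic (n + 1)).inf' Finset.nonempty_Iic (fun t => g (tvtraj f π x d t)) =
      min (g x) ((Finset.Iic n).inf' Finset.nonempty_Iic fun t =>
        g (tvtraj f (fun s => π (s + 1)) (f x (π 0 x) (d 0)) (fun s => d (s + 1)) t)) := by
  simp only [inf'_Iic_succ, tvtraj_succ]
  rfl

/-- A single policy is optimal from every initial state. -/
theorem exists_policy_forall_W_le {X U D : Type*} [Fintype U] [Nonempty U]
    [Fintype D] [Nonempty D] (f : X → U → D → X) (g : X → ℝ) (n : ℕ) :
    ∃ π : ℕ → X → U, ∀ (x : X) (d : ℕ → D),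
      W f g n x ≤
        (Finset.Iic n).inf' Finset.nonempty_Iic (fun t => g (tvtraj f π x d t)) := by
  induction n with
  | zero =>
    refine ⟨fun _ _ => Classical.arbitrary U, fun x d => Finset.le_inf' _ _ fun t ht => ?_⟩
    obtain rfl : t = 0 := by simpa using ht
    exact le_rfl
  | succ n ih =>
    obtain ⟨π, hπ⟩ := ih
    choose u _ hu using fun x : X => Finset.exists_mem_eq_sup' Finset.univ_nonempty fun u : U =>
      Finset.univ.inf' Finset.univ_nonempty fun d : D => W f g n (f x u d)
    refine ⟨fun t => Nat.casesOn t u π, fun x d => ?_⟩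
    rw [payoff_succ, W]
    exact min_le_min_left _ ((hu x).le.trans
      ((Finset.inf'_le _ (Finset.mem_univ (d 0))).trans (hπ _ _)))

theorem exists_disturbance_le_W {X U D : Type*} [Fintype U] [Nonempty U]
    [Fintype D] [Nonempty D] (f : X → U → D → X) (g : X → ℝ) (n : ℕ) (x : X)
    (π : ℕ → X → U) :
    ∃ d : ℕ → D,
      (Finset.Iic n).inf' Finset.nonempty_Iic (fun t => g (tvtraj f π x d t)) ≤
        W f g n x := by
  induction n generalizing x π with
  | zero =>
    exact ⟨fun _ => Classical.arbitrary D,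
      Finset.inf'_le (fun t => g (tvtraj f π x _ t)) (Finset.mem_Iic.2 le_rfl)⟩
  | succ n ih =>
    obtain ⟨d₀, _, hd₀⟩ := Finset.exists_mem_eq_inf' Finset.univ_nonempty
      fun d : D => W f g n (f x (π 0 x) d)
    obtain ⟨d, hd⟩ := ih (f x (π 0 x) d₀) fun s => π (s + 1)
    refine ⟨fun t => Nat.casesOn t d₀ d, ?_⟩
    rw [payoff_succ, W]
    refine min_le_min_left _ (hd.trans (hd₀.symm.le.trans ?_))
    exact Finset.le_sup' (fun u : U =>
      Finset.univ.inf' Finset.univ_nonempty fun d : D => W f g n (f x u d))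
      (Finset.mem_univ (π 0 x))

/-- Finite-horizon game value: `W n x` is the upper value of the finite-horizon game of
degree with payoff `min_{t ≤ n} g (x_t)`:
(i) some time-varying feedback policy guarantees payoff at least `W n x` against every
disturbance sequence, and
(ii) against every time-varying feedback policy some disturbance sequence forces payoff
at most `W n x`. -/
theorem stmt_11 {X U D : Type*} [Nonempty X] [Fintype U] [Nonempty U]
    [Fintype D] [Nonempty D] (f : X → U → D → X) (g : X → ℝ) :
    ∀ (n : ℕ) (x : X),
      (∃ π : ℕ → X → U, ∀ d : ℕ → D,
        (Finset.Iic n).inf' Finset.nonempty_Iic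
          (fun t => g (tvtraj f π x d t)) ≥ W f g n x) ∧
      (∀ π : ℕ → X → U, ∃ d : ℕ → D,
        (Finset.Iic n).inf' Finset.nonempty_Iic
          (fun t => g (tvtraj f π x d t)) ≤ W f g n x) := by
  intro n x
  obtain ⟨π, hπ⟩ := exists_policy_forall_W_le f g n
  exact ⟨⟨π, hπ x⟩, exists_disturbance_le_W f g n x⟩
end

section
/- (Value function encodes the maximal safe set) Suppose g is bounded below, let F := {x | g x < 0}, and let V∞ x := ⨅ n, W n x be the infinite-horizon safety value. Then the zero-superlevel set of V∞ equals the maximal robust safe set: {x | V∞ x ≥ 0} = {x | there exists a stationary policy π : X → U that is robustly safe from x}. -/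
section

variable {X U D : Type*} [Fintype U] [Nonempty U] [Fintype D] [Nonempty D]
  (f : X → U → D → X) (g : X → ℝ)

theorem le_W_succ_iff (n : ℕ) (x : X) (c : ℝ) :
    c ≤ W f g (n + 1) x ↔ c ≤ g x ∧ ∃ u, ∀ d, c ≤ W f g n (f x u d) := by
  simp [W, Finset.le_sup'_iff, Finset.le_inf'_iff]

theorem W_succ_le (n : ℕ) (x : X) : W f g (n + 1) x ≤ W f g n x := by
  induction n generalizing x with
  | zero => exact min_le_left _ _
  | succ n ih =>
    refine le_of_forall_le fun c hc => ?_
    obtain ⟨hg, u, hu⟩ := (le_W_succ_iff f g (n + 1) x c).1 hc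
    exact (le_W_succ_iff f g n x c).2 ⟨hg, u, fun d => (hu d).trans (ih _)⟩

theorem W_antitone (x : X) : Antitone fun n => W f g n x :=
  antitone_nat_of_succ_le fun n => W_succ_le f g n x

variable {g} in
theorem le_W_of_forall_le {B : ℝ} (hB : ∀ x, B ≤ g x) (n : ℕ) (x : X) : B ≤ W f g n x := by
  induction n generalizing x with
  | zero => exact hB x
  | succ n ih => exact (le_W_succ_iff f g n x B).2 ⟨hB x, Classical.arbitrary U, fun d => ih _⟩

variable {f g} in
/-- A single control works for all horizons at once, since there are finitely many controls and
`W` decreases with the horizon. -/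
theorem exists_control_of_forall_le_W {x : X} {c : ℝ} (h : ∀ n, c ≤ W f g n x) :
    ∃ u, ∀ d n, c ≤ W f g n (f x u d) := by
  by_contra! hneg
  choose d n hn using hneg
  obtain ⟨-, u, hu⟩ := (le_W_succ_iff f g (Finset.univ.sup n) x c).1 (h _)
  have hle : W f g (Finset.univ.sup n) (f x u (d u)) ≤ W f g (n u) (f x u (d u)) :=
    W_antitone f g _ (Finset.le_sup (Finset.mem_univ u))
  exact absurd ((hu (d u)).trans hle) (hn u).not_ge

end

theorem traj_cons {X U D : Type*} (f : X → U → D → X) (π : X → U) (x : X) (a : D) (d : ℕ → D)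
    (t : ℕ) :
    traj f π x (fun k => Nat.casesOn k a d) (t + 1) = traj f π (f x (π x) a) d t := by
  induction t with
  | zero => rfl
  | succ t ih => rw [traj, ih, traj]

theorem le_W_of_forall_traj {X U D : Type*} [Fintype U] [Nonempty U] [Fintype D] [Nonempty D]
    {f : X → U → D → X} {g : X → ℝ} {π : X → U} {c : ℝ} {x : X}
    (h : ∀ d t, c ≤ g (traj f π x d t)) (n : ℕ) : c ≤ W f g n x := by
  have hx : c ≤ g x := h (fun _ => Classical.arbitrary D) 0
  induction n generalizing x with
  | zero => exact hx
  | succ n ih =>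
    refine (le_W_succ_iff f g n x c).2 ⟨hx, π x, fun a => ?_⟩
    have ha : ∀ d t, c ≤ g (traj f π (f x (π x) a) d t) := fun d t => by
      rw [← traj_cons]
      exact h _ _
    exact ih ha (ha (fun _ => Classical.arbitrary D) 0)

/-- Value function encodes the maximal safe set: if `g` is bounded below, the
zero-superlevel set of the infinite-horizon value `V∞ x = ⨅ n, W n x` equals the set of
states from which some stationary policy is robustly safe with respect to the failure
set `F = {x | g x < 0}`. -/
theorem stmt_15 {X U D : Type*} [Nonempty X] [Fintype U] [Nonempty U]
    [Fintype D] [Nonempty D] (f : X → U → D → X) (g : X → ℝ)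
    (hB : ∃ B : ℝ, ∀ x : X, g x ≥ B) :
    {x : X | (⨅ n : ℕ, W f g n x) ≥ 0} =
      {x : X | ∃ π : X → U, ∀ d : ℕ → D, ∀ t : ℕ,
        traj f π x d t ∉ {y : X | g y < 0}} := by
  have hbdd (x : X) : BddBelow (Set.range fun n => W f g n x) := by
    obtain ⟨B, hB⟩ := hB
    exact ⟨B, Set.forall_mem_range.2 fun n => le_W_of_forall_le f hB n x⟩
  ext x
  simp only [Set.mem_ofPred_eq, ge_iff_le, not_lt, le_ciInf_iff (hbdd x)]
  constructor
  · intro hx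
    have hπ (y : X) : ∃ u, (∀ n, 0 ≤ W f g n y) → ∀ d n, 0 ≤ W f g n (f y u d) := by
      by_cases hy : ∀ n, 0 ≤ W f g n y
      · obtain ⟨u, hu⟩ := exists_control_of_forall_le_W hy
        exact ⟨u, fun _ => hu⟩
      · exact ⟨Classical.arbitrary U, fun h => absurd h hy⟩
    choose π hπ using hπ
    refine ⟨π, fun d t => ?_⟩
    have key : ∀ n, 0 ≤ W f g n (traj f π x d t) := by
      induction t with
      | zero => exact hx
      | succ t ih => exact hπ _ ih (d t)
    exact key 0
  · rintro ⟨π, hπ⟩ n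
    exact le_W_of_forall_traj hπ n
end
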